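/- arXiv:1503.07969 — 9 statements merged into one kernel-verified Lean document; each statement's English description precedes it below -/
import Mathlib

section
/- Let n ≥ 3 be an integer. In the Laurent polynomial ring ℤ[t,t⁻¹], the ideal generated by the three elements t^(n-1) - 1 + t, 1 - t + t², and t^(n-2) - t^(n-1) + 1 is equal to the ideal generated by the two elements 1 - t^n and 1 - t + t². (This is the computation of the (n-1)-st Alexander ideal of Suzuki's theta-n curve, due to Sato.) -/
open LaurentPolynomial

/-- Sato's computation: for `n ≥ 3`, in `ℤ[t,t⁻¹]` the ideal
`(t^(n-1) - 1 + t, 1 - t + t², t^(n-2) - t^(n-1) + 1)` equals `(1 - t^n, 1 - t + t²)`. -/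
theorem sato_alexander_ideal (n : ℤ) (hn : 3 ≤ n) :
    (Ideal.span {T (n - 1) - 1 + T 1, 1 - T 1 + T 2, T (n - 2) - T (n - 1) + 1} :
      Ideal (LaurentPolynomial ℤ)) =
    Ideal.span {1 - T n, 1 - T 1 + T 2} := by
  have h2 : (T 2 : LaurentPolynomial ℤ) = T 1 * T 1 := by rw [← T_add]; norm_num
  have h1 : (T (n - 1) : LaurentPolynomial ℤ) = T (n - 2) * T 1 := by
    rw [← T_add]; congr 1; ring
  have h0 : (T n : LaurentPolynomial ℤ) = T (n - 2) * (T 1 * T 1) := by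
    rw [← T_add, ← T_add]; congr 1; ring
  have hinv : (T (-1) * T 1 : LaurentPolynomial ℤ) = 1 := by rw [← T_add]; simp
  rw [h0, h1, h2]
  generalize (T (n - 2) : LaurentPolynomial ℤ) = u
  apply le_antisymm <;> rw [Ideal.span_le]
  · rintro x (rfl | rfl | rfl) <;> rw [SetLike.mem_coe, Ideal.mem_span_pair]
    · exact ⟨-T (-1), T (-1), by linear_combination (u * T 1 - 1 + T 1) * hinv⟩
    · exact ⟨0, 1, by ring⟩
    · exact ⟨1, u, by ring⟩
  · rintro x (rfl | rfl)
    · rw [SetLike.mem_coe, Ideal.mem_span_insert']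
      refine ⟨0, Ideal.mem_span_pair.2 ⟨-u, 1, by ring⟩⟩
    · exact Ideal.subset_span (by simp)
end

section
/- Let n ≥ 3 be an integer with n ≡ 1 (mod 6) or n ≡ 5 (mod 6). In the Laurent polynomial ring ℤ[t,t⁻¹], the ideal generated by 1 - t + t² and 1 - t^n is the whole ring (the unit ideal). -/
open LaurentPolynomial

/-- A common zero of `1 - x + x²` and `1 - x ^ m`, with `m ≡ 1, 5 (mod 6)`, exists only in the
zero ring. -/
theorem one_eq_zero_of_one_sub_add_sq_eq_zero {R : Type*} [CommRing R] {x : R} {m : ℕ}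
    (hx : 1 - x + x ^ 2 = 0) (hm : 1 - x ^ m = 0) (h : m % 6 = 1 ∨ m % 6 = 5) :
    (1 : R) = 0 := by
  have h6 : x ^ 6 = 1 := by linear_combination (x ^ 4 + x ^ 3 - x - 1) * hx
  rw [← Nat.div_add_mod m 6, pow_add, pow_mul, h6, one_pow, one_mul] at hm
  have hx1 : x = 1 := by
    rcases h with h | h <;> rw [h] at hm
    · linear_combination -hm
    · linear_combination x * hm + h6
  simpa [hx1] using hx

/-- For `n ≥ 3` with `n ≡ 1, 5 (mod 6)`, the ideal `(1 - t + t², 1 - t^n)` of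
`ℤ[t,t⁻¹]` is the unit ideal. -/
theorem ideal_eq_top_of_mod_six_eq_one_or_five (n : ℤ) (hn : 3 ≤ n)
    (h : n % 6 = 1 ∨ n % 6 = 5) :
    (Ideal.span {1 - T 1 + T 2, 1 - T n} : Ideal (LaurentPolynomial ℤ)) = ⊤ := by
  lift n to ℕ using by lia
  set I : Ideal (LaurentPolynomial ℤ) := Ideal.span {1 - T 1 + T 2, 1 - T (n : ℤ)}
  have hT (k : ℕ) : (T (k : ℤ) : LaurentPolynomial ℤ) = T 1 ^ k := by simp [T_pow]
  have h1 : Ideal.Quotient.mk I (1 - T 1 + T 2) = 0 :=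
    Ideal.Quotient.eq_zero_iff_mem.2 (Ideal.subset_span (by simp))
  have h2 : Ideal.Quotient.mk I (1 - T (n : ℤ)) = 0 :=
    Ideal.Quotient.eq_zero_iff_mem.2 (Ideal.subset_span (by simp))
  rw [show (2 : ℤ) = (2 : ℕ) from rfl, hT] at h1
  rw [hT] at h2
  simp only [map_add, map_sub, map_one, map_pow] at h1 h2
  rw [Ideal.eq_top_iff_one, ← Ideal.Quotient.eq_zero_iff_mem, map_one]
  exact one_eq_zero_of_one_sub_add_sq_eq_zero h1 h2 (by lia)
end

section
/- Let n ≥ 3 be an integer with n ≡ 2 (mod 6) or n ≡ 4 (mod 6). In the Laurent polynomial ring ℤ[t,t⁻¹], the ideal generated by 1 - t + t² and 1 - t^n is equal to the ideal generated by 3 and 1 + t. -/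
open LaurentPolynomial

/-- Since `1 - t + t²` divides `t⁶ - 1`, it divides `t^(6k) - 1`. -/
lemma one_sub_add_sq_dvd_pow_six_mul_sub_one {R : Type*} [CommRing R] (t : R) (k : ℕ) :
    1 - t + t ^ 2 ∣ t ^ (6 * k) - 1 := by
  have h : 1 - t + t ^ 2 ∣ t ^ 6 - 1 := ⟨(t + 1) * (t ^ 3 - 1), by ring⟩
  rw [pow_mul]
  exact h.trans (sub_one_dvd_pow_sub_one _ k)

lemma span_one_sub_add_sq_eq_of_mod_two {R : Type*} [CommRing R] (t : R) (k : ℕ) :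
    Ideal.span {1 - t + t ^ 2, 1 - t ^ (6 * k + 2)} = Ideal.span {3, 1 + t} := by
  obtain ⟨c, hc⟩ := one_sub_add_sq_dvd_pow_six_mul_sub_one t k
  rw [pow_add, eq_add_of_sub_eq hc]
  apply le_antisymm <;> rw [Ideal.span_le, Set.pair_subset_iff] <;>
    simp only [SetLike.mem_coe, Ideal.mem_span_pair]
  · exact ⟨⟨1, t - 2, by ring⟩, ⟨-t ^ 2 * c, 1 - t - t ^ 2 * c * (t - 2), by ring⟩⟩
  · exact ⟨⟨1 + (t + 1) * (1 + t ^ 2 * c), t + 1, by ring⟩,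
      ⟨1 + t * (1 + t ^ 2 * c), t, by ring⟩⟩

lemma span_one_sub_add_sq_eq_of_mod_four {R : Type*} [CommRing R] (t : R) (k : ℕ) :
    Ideal.span {1 - t + t ^ 2, 1 - t ^ (6 * k + 4)} = Ideal.span {3, 1 + t} := by
  obtain ⟨c, hc⟩ := one_sub_add_sq_dvd_pow_six_mul_sub_one t k
  rw [pow_add, eq_add_of_sub_eq hc]
  apply le_antisymm <;> rw [Ideal.span_le, Set.pair_subset_iff] <;>
    simp only [SetLike.mem_coe, Ideal.mem_span_pair]
  · exact ⟨⟨1, t - 2, by ring⟩,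
      ⟨-t ^ 4 * c, (1 - t) * (1 + t ^ 2) - t ^ 4 * c * (t - 2), by ring⟩⟩
  · exact ⟨⟨1 - (t - 2) * (t * (1 + t) + t ^ 4 * c), -(t - 2), by ring⟩,
      ⟨t * (1 + t) + t ^ 4 * c, 1, by ring⟩⟩

/-- For `n ≥ 3` with `n ≡ 2, 4 (mod 6)`, the ideal `(1 - t + t², 1 - t^n)` of
`ℤ[t,t⁻¹]` equals `(3, 1 + t)`. -/
theorem ideal_eq_of_mod_six_eq_two_or_four (n : ℤ) (hn : 3 ≤ n)
    (h : n % 6 = 2 ∨ n % 6 = 4) :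
    (Ideal.span {1 - T 1 + T 2, 1 - T n} : Ideal (LaurentPolynomial ℤ)) =
      Ideal.span {3, 1 + T 1} := by
  lift n to ℕ using by lia
  have hT (m : ℕ) : (T (m : ℤ) : LaurentPolynomial ℤ) = T 1 ^ m := by simp [T_pow]
  have hT2 : (T 2 : LaurentPolynomial ℤ) = T 1 ^ 2 := hT 2
  rw [hT, hT2]
  rcases h with h | h
  · obtain ⟨k, rfl⟩ : ∃ k, n = 6 * k + 2 := ⟨n / 6, by lia⟩
    exact span_one_sub_add_sq_eq_of_mod_two _ k
  · obtain ⟨k, rfl⟩ : ∃ k, n = 6 * k + 4 := ⟨n / 6, by lia⟩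
    exact span_one_sub_add_sq_eq_of_mod_four _ k
end

section
/- Let n ≥ 3 be an integer with n ≡ 3 (mod 6). In the Laurent polynomial ring ℤ[t,t⁻¹], the ideal generated by 1 - t + t² and 1 - t^n is equal to the ideal generated by 2 and 1 - t + t². -/
open LaurentPolynomial

/-- If `n ≡ 3 (mod 6)` and `n ≥ 3`, then `1 - t + t²` divides `1 + t ^ n`. -/
theorem one_sub_T_add_T_dvd_one_add_T {R : Type*} [CommRing R] (n : ℤ) (hn : 3 ≤ n)
    (h : n % 6 = 3) : (1 - T 1 + T 2 : LaurentPolynomial R) ∣ 1 + T n := by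
  obtain ⟨k, rfl⟩ : ∃ k : ℕ, n = ((2 * k + 1 : ℕ) : ℤ) * 3 := ⟨(n / 6).toNat, by omega⟩
  have hodd := (odd_two_mul_add_one k).add_dvd_pow_add_pow (T 3 : LaurentPolynomial R) 1
  rw [one_pow, T_pow, add_comm _ (1 : LaurentPolynomial R),
    add_comm _ (1 : LaurentPolynomial R)] at hodd
  refine dvd_trans ⟨1 + T 1, ?_⟩ hodd
  have h2 : (T 2 : LaurentPolynomial R) = T 1 ^ 2 := by simp [T_pow]
  have h3 : (T 3 : LaurentPolynomial R) = T 1 ^ 3 := by simp [T_pow]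
  rw [h2, h3]
  ring

/-- For `n ≥ 3` with `n ≡ 3 (mod 6)`, the ideal `(1 - t + t², 1 - t^n)` of
`ℤ[t,t⁻¹]` equals `(2, 1 - t + t²)`. -/
theorem ideal_eq_of_mod_six_eq_three (n : ℤ) (hn : 3 ≤ n) (h : n % 6 = 3) :
    (Ideal.span {1 - T 1 + T 2, 1 - T n} : Ideal (LaurentPolynomial ℤ)) =
      Ideal.span {2, 1 - T 1 + T 2} := by
  obtain ⟨q, hq⟩ := one_sub_T_add_T_dvd_one_add_T (R := ℤ) n hn h
  apply le_antisymm <;> rw [Ideal.span_le, Set.pair_subset_iff] <;>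
    simp only [SetLike.mem_coe, Ideal.mem_span_pair]
  · exact ⟨⟨0, 1, by ring⟩, ⟨1, -q, by linear_combination hq⟩⟩
  · exact ⟨⟨q, 1, by linear_combination -hq⟩, ⟨1, 0, by ring⟩⟩
end

section
/- Let n ≥ 3 be an integer and let R = ℤ[X]/(X^n - 1) be the quotient of the polynomial ring ℤ[X] by the principal ideal generated by X^n - 1. Then the ideal of R generated by the images of the three polynomials X^(n-1) - 1 + X, 1 - X + X², and X^(n-2) - X^(n-1) + 1 is equal to the principal ideal of R generated by the image of 1 - X + X². (This is Suzuki's computation of the (n-1)-st Alexander ideal of the theta-n curve with respect to the abelianization onto ℤ/nℤ.) -/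
open Polynomial

/-- Suzuki's computation: for `n ≥ 3`, in `ℤ[X]/(X^n - 1)` the ideal generated by
the images of `X^(n-1) - 1 + X`, `1 - X + X²`, `X^(n-2) - X^(n-1) + 1` equals the
principal ideal generated by the image of `1 - X + X²`. -/
theorem suzuki_alexander_ideal (n : ℕ) (hn : 3 ≤ n) :
    (Ideal.span
      {Ideal.Quotient.mk (Ideal.span {(X : ℤ[X]) ^ n - 1}) (X ^ (n - 1) - 1 + X),
       Ideal.Quotient.mk (Ideal.span {(X : ℤ[X]) ^ n - 1}) (1 - X + X ^ 2),
       Ideal.Quotient.mk (Ideal.span {(X : ℤ[X]) ^ n - 1})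
         (X ^ (n - 2) - X ^ (n - 1) + 1)}) =
    Ideal.span {Ideal.Quotient.mk (Ideal.span {(X : ℤ[X]) ^ n - 1}) (1 - X + X ^ 2)} := by
  obtain ⟨m, rfl⟩ : ∃ m, n = m + 2 := ⟨n - 2, by omega⟩
  simp only [show m + 2 - 1 = m + 1 by omega, Nat.add_sub_cancel, map_add, map_sub, map_pow,
    map_one]
  have hx : Ideal.Quotient.mk (Ideal.span {(X : ℤ[X]) ^ (m + 2) - 1}) X ^ (m + 2) = 1 := by
    rw [← map_pow, ← map_one (Ideal.Quotient.mk _), Ideal.Quotient.eq]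
    exact Ideal.mem_span_singleton_self _
  generalize Ideal.Quotient.mk (Ideal.span {(X : ℤ[X]) ^ (m + 2) - 1}) X = x at hx ⊢
  apply le_antisymm
  · rw [Ideal.span_le]
    rintro y (rfl | rfl | rfl) <;> rw [SetLike.mem_coe, Ideal.mem_span_singleton]
    · exact ⟨x ^ (m + 1), by linear_combination (1 - x) * hx⟩
    · exact ⟨x ^ m, by linear_combination -hx⟩
  · exact Ideal.span_mono (by simp)
end

section
/- Let n ≥ 3 be an integer with n ≡ 1 (mod 6) or n ≡ 5 (mod 6). Then the image of the polynomial 1 - X + X² in the quotient ring ℤ[X]/(X^n - 1) is a unit. -/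
open Polynomial

/-- If `x ^ n = 1` in a commutative ring with `n` coprime to `6`, then `1 - x + x ^ 2` is a unit. -/
theorem isUnit_one_sub_add_sq_of_pow_eq_one {R : Type*} [CommRing R] {x : R} {n : ℕ}
    (hx : x ^ n = 1) (h : n % 6 = 1 ∨ n % 6 = 5) : IsUnit (1 - x + x ^ 2) := by
  have hdvd : 1 - x + x ^ 2 ∣ (x ^ 6) ^ (n / 6) - 1 :=
    Dvd.dvd.trans ⟨(x + 1) * (x ^ 3 - 1), by ring⟩ (sub_one_dvd_pow_sub_one (x ^ 6) (n / 6))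
  obtain ⟨c, hc⟩ := hdvd
  have hn : (x ^ 6) ^ (n / 6) * x ^ (n % 6) = 1 := by
    rw [← pow_mul, ← pow_add, Nat.div_add_mod, hx]
  rcases h with h | h <;> rw [h] at hn
  · refine IsUnit.of_mul_eq_one (1 + x ^ 2 * c) ?_
    linear_combination x * hn - x ^ 2 * hc
  · refine IsUnit.of_mul_eq_one (1 + (1 - x) * (x ^ 5 * c - 1 + x ^ 2 * (x + 1))) ?_
    linear_combination (1 - x) * hn - (1 - x) * x ^ 5 * hc

/-- For `n ≥ 3` with `n ≡ 1, 5 (mod 6)`, the image of `1 - X + X²` in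
`ℤ[X]/(X^n - 1)` is a unit. -/
theorem isUnit_image_of_mod_six_eq_one_or_five (n : ℕ) (hn : 3 ≤ n)
    (h : n % 6 = 1 ∨ n % 6 = 5) :
    IsUnit (Ideal.Quotient.mk (Ideal.span {(X : ℤ[X]) ^ n - 1}) (1 - X + X ^ 2)) := by
  have hx : Ideal.Quotient.mk (Ideal.span {(X : ℤ[X]) ^ n - 1}) X ^ n = 1 := by
    rw [← map_pow, ← map_one (Ideal.Quotient.mk _), Ideal.Quotient.mk_eq_mk_iff_sub_mem]
    exact Ideal.mem_span_singleton_self _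
  simpa using isUnit_one_sub_add_sq_of_pow_eq_one hx h
end

section
/- Let k ≥ 0 and n = 6k + 5. Define matrices M₁, …, Mₙ in the group of invertible 2×2 matrices over the field ℤ/2ℤ by: Mᵢ = [[0,1],[1,1]] for 1 ≤ i ≤ 6k+3, M_{6k+4} = [[0,1],[1,0]], and M_{6k+5} = [[1,0],[1,1]], and set M₀ = Mₙ. Then the ordered product over i = 1, 2, …, n of the conjugates Mᵢ · M_{i-1} · Mᵢ⁻¹ is the identity matrix. (This is the relation ρ(r) = E showing that the assignment ρ defines a group representation of the group of Suzuki's theta-(6k+5) curve into SL(2, ℤ/2ℤ).) -/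
/-- For `n = 6k + 5`, the ordered product of the conjugates
`Mᵢ · M_{i-1} · Mᵢ⁻¹` (for `i = 1, …, n`, with `M₀ = Mₙ`) of the matrices of
Lemma 3.5 is the identity: the map `ρ` is a representation of the group of
Suzuki's theta-`(6k+5)` curve into `SL(2, ℤ/2ℤ)`. -/
theorem suzuki_rep_relation_6k5 (k n : ℕ) (hn : n = 6 * k + 5)
    (M : ℕ → Matrix (Fin 2) (Fin 2) (ZMod 2))
    (h1 : ∀ i, 1 ≤ i → i ≤ 6 * k + 3 → M i = !![0, 1; 1, 1])
    (h2 : M (6 * k + 4) = !![0, 1; 1, 0])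
    (h3 : M (6 * k + 5) = !![1, 0; 1, 1])
    (h0 : M 0 = M n) :
    ((List.range n).map (fun i => M (i + 1) * M i * (M (i + 1))⁻¹)).prod = 1 := by
  have hA : (!![0, 1; 1, 1] : Matrix (Fin 2) (Fin 2) (ZMod 2))⁻¹ = !![1, 1; 1, 0] :=
    Matrix.inv_eq_right_inv (by decide)
  have hB : (!![0, 1; 1, 0] : Matrix (Fin 2) (Fin 2) (ZMod 2))⁻¹ = !![0, 1; 1, 0] :=
    Matrix.inv_eq_right_inv (by decide)
  have hC : (!![1, 0; 1, 1] : Matrix (Fin 2) (Fin 2) (ZMod 2))⁻¹ = !![1, 0; 1, 1] :=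
    Matrix.inv_eq_right_inv (by decide)
  have hA3 : (!![0, 1; 1, 1] : Matrix (Fin 2) (Fin 2) (ZMod 2)) ^ 3 = 1 := by decide
  have hA_conj : (!![0, 1; 1, 1] * !![0, 1; 1, 1] * !![1, 1; 1, 0] :
      Matrix (Fin 2) (Fin 2) (ZMod 2)) = !![0, 1; 1, 1] := by decide
  subst hn
  rw [h3] at h0
  have partial_prod : ∀ m, m ≤ 6 * k + 2 →
      ((List.range (m + 1)).map (fun i => M (i + 1) * M i * (M (i + 1))⁻¹)).prod =
        !![0, 1; 1, 1] * !![1, 0; 1, 1] * !![1, 1; 1, 0] * !![0, 1; 1, 1] ^ m := by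
    intro m
    induction m with
    | zero =>
      intro _
      simp only [zero_add, List.range_one, List.map_cons, List.map_nil, List.prod_singleton,
        h0, h1 1 le_rfl (by omega), hA, pow_zero, mul_one]
    | succ m ih =>
      intro hm
      rw [List.range_succ, List.map_append, List.prod_append, ih (by omega), List.map_singleton,
        List.prod_singleton, h1 (m + 1 + 1) (by omega) (by omega),
        h1 (m + 1) (by omega) (by omega), hA, hA_conj, pow_succ, mul_assoc _ (_ ^ m)]
  rw [List.range_succ, List.range_succ, List.map_append, List.map_append, List.prod_append,
    List.prod_append, partial_prod (6 * k + 2) le_rfl, List.map_singleton, List.map_singleton,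
    List.prod_singleton, List.prod_singleton, h3, h2, h1 (6 * k + 3) (by omega) le_rfl, hB, hC,
    show 6 * k + 2 = 3 * (2 * k) + 2 by ring, pow_add, pow_mul, hA3, one_pow]
  decide
end

section
/- Let k ≥ 0 and n = 6k + 7. Define matrices M₁, …, Mₙ in the group of invertible 2×2 matrices over the field ℤ/2ℤ by: Mᵢ = [[0,1],[1,1]] for 1 ≤ i ≤ 6k+3, M_{6k+4} = [[0,1],[1,0]], M_{6k+5} = [[1,0],[1,1]], M_{6k+6} = [[0,1],[1,0]], and M_{6k+7} = [[1,0],[1,1]], and set M₀ = Mₙ. Then the ordered product over i = 1, 2, …, n of the conjugates Mᵢ · M_{i-1} · Mᵢ⁻¹ is the identity matrix. (This is the relation ρ(r) = E showing that the assignment ρ defines a group representation of the group of Suzuki's theta-(6k+7) curve into SL(2, ℤ/2ℤ).) -/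
/-- If `M 1 = ⋯ = M (m + 1) = A`, all conjugates after the first one are equal to `A`. -/
theorem prod_map_conj_of_eq {R : Type*} [CommRing R] {d : Type*} [Fintype d] [DecidableEq d]
    (M : ℕ → Matrix d d R) (A : Matrix d d R) (hA : IsUnit A.det) (m : ℕ)
    (hM : ∀ i, 1 ≤ i → i ≤ m + 1 → M i = A) :
    ((List.range (m + 1)).map (fun i => M (i + 1) * M i * (M (i + 1))⁻¹)).prod =
      A * M 0 * A⁻¹ * A ^ m := by
  induction m with
  | zero => simp [hM 1 le_rfl le_rfl]
  | succ m ih =>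
    rw [List.range_succ, List.map_append, List.prod_append,
      ih fun i hi hi' => hM i hi (by omega)]
    simp only [List.map_cons, List.map_nil, List.prod_singleton]
    rw [hM (m + 1) (by omega) (by omega), hM (m + 1 + 1) (by omega) (by omega),
      Matrix.mul_nonsing_inv_cancel_right A A hA, pow_succ]
    simp only [mul_assoc]

/-- For `n = 6k + 7`, the ordered product of the conjugates
`Mᵢ · M_{i-1} · Mᵢ⁻¹` (for `i = 1, …, n`, with `M₀ = Mₙ`) of the matrices of
Lemma 3.5 is the identity: the map `ρ` is a representation of the group of
Suzuki's theta-`(6k+7)` curve into `SL(2, ℤ/2ℤ)`. -/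
theorem suzuki_rep_relation_6k7 (k n : ℕ) (hn : n = 6 * k + 7)
    (M : ℕ → Matrix (Fin 2) (Fin 2) (ZMod 2))
    (h1 : ∀ i, 1 ≤ i → i ≤ 6 * k + 3 → M i = !![0, 1; 1, 1])
    (h2 : M (6 * k + 4) = !![0, 1; 1, 0])
    (h3 : M (6 * k + 5) = !![1, 0; 1, 1])
    (h4 : M (6 * k + 6) = !![0, 1; 1, 0])
    (h5 : M (6 * k + 7) = !![1, 0; 1, 1])
    (h0 : M 0 = M n) :
    ((List.range n).map (fun i => M (i + 1) * M i * (M (i + 1))⁻¹)).prod = 1 := by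
  subst hn
  have hA : (!![0, 1; 1, 1] : Matrix (Fin 2) (Fin 2) (ZMod 2))⁻¹ = !![1, 1; 1, 0] :=
    Matrix.inv_eq_right_inv (by decide)
  have hP : (!![0, 1; 1, 0] : Matrix (Fin 2) (Fin 2) (ZMod 2))⁻¹ = !![0, 1; 1, 0] :=
    Matrix.inv_eq_right_inv (by decide)
  have hQ : (!![1, 0; 1, 1] : Matrix (Fin 2) (Fin 2) (ZMod 2))⁻¹ = !![1, 0; 1, 1] :=
    Matrix.inv_eq_right_inv (by decide)
  have hA3 : (!![0, 1; 1, 1] : Matrix (Fin 2) (Fin 2) (ZMod 2)) ^ 3 = 1 := by decide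
  have hpow : (!![0, 1; 1, 1] : Matrix (Fin 2) (Fin 2) (ZMod 2)) ^ (6 * k + 2) =
      !![0, 1; 1, 1] ^ 2 := by
    rw [show 6 * k + 2 = 3 * (2 * k) + 2 by ring, pow_add, pow_mul, hA3, one_pow, one_mul]
  have h_init := prod_map_conj_of_eq M !![0, 1; 1, 1] (by simp [Matrix.det_fin_two]) (6 * k + 2) h1
  rw [h0, h5, hpow, hA] at h_init
  rw [show 6 * k + 7 = 6 * k + 2 + 1 + 1 + 1 + 1 + 1 by ring]
  iterate 4 rw [List.range_succ, List.map_append, List.prod_append]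
  rw [h_init]
  simp only [List.map_cons, List.map_nil, List.prod_singleton, add_assoc, Nat.reduceAdd]
  rw [h1 (6 * k + 3) (by omega) le_rfl, h2, h3, h4, h5, hP, hQ]
  decide
end

section
/- Let k ≥ 0 and n = 6k + 5. Work over R = (ℤ/2ℤ)[t,t⁻¹], the Laurent polynomial ring over the field ℤ/2ℤ. Define 2×2 matrices B₁, …, Bₙ over R as follows: B₁ = t^(−(6k+4))·[[t + t^(6k+4), 1+t],[1, t + t^(6k+4)]]; for 2 ≤ j ≤ 6k+2 with j ≡ 2 (mod 3), B_j = t^(j−6k−6)·[[t+t², 1+t],[1+t², t+t²]]; for 3 ≤ j ≤ 6k with j ≡ 0 (mod 3), B_j = t^(j−6k−6)·[[1+t, 1+t²],[t+t², 1+t]]; for 4 ≤ j ≤ 6k+1 with j ≡ 1 (mod 3), B_j = t^(j−6k−6)·[[1+t², t+t²],[1+t, 1+t²]]; B_{6k+3} = t^(−3)·[[1+t, 1+t²],[t+t², 1+t+t²]]; B_{6k+4} = t^(−(6k+5))·[[t^(6k+3)+t^(6k+4), 1+t^(6k+4)],[1+t^(6k+3), 1+t^(6k+3)+t^(6k+4)]];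 B_{6k+5} = t^(−1)·[[1+t, 1+t²],[t², 1+t+t²]]. Let A be the 2×(2n) matrix over R obtained by concatenating the blocks B₁, …, Bₙ left to right. Then the ideal of R generated by all 2×2 minors of A equals the principal ideal generated by 1 + t. (This is the computation of the (2n−2)-nd twisted Alexander ideal of Suzuki's theta-n curve for n ≡ 5 (mod 6), showing it equals (1+t).) -/
open LaurentPolynomial

set_option maxHeartbeats 1000000

lemma two_eq_zero_laurent : (2 : LaurentPolynomial (ZMod 2)) = 0 := by
  have h : (2 : LaurentPolynomial (ZMod 2)) = C 2 := (map_ofNat C 2).symm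
  rw [h, show (2 : ZMod 2) = 0 from rfl, map_zero]

lemma one_add_T_one_dvd_one_add_T (m : ℕ) :
    (1 + T 1 : LaurentPolynomial (ZMod 2)) ∣ 1 + T (m : ℤ) := by
  induction m with
  | zero =>
    rw [Nat.cast_zero, T_zero, one_add_one_eq_two, two_eq_zero_laurent]
    exact dvd_zero _
  | succ m ih =>
    have h : (1 + T ((m + 1 : ℕ) : ℤ) : LaurentPolynomial (ZMod 2)) =
        T m * (1 + T 1) + (1 + T m) := by
      rw [Nat.cast_succ, T_add]
      linear_combination (-T (m : ℤ)) * two_eq_zero_laurent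
    rw [h]
    exact dvd_add (dvd_mul_left _ _) ih

lemma one_add_T_one_dvd_T_add_T {a b : ℤ} (hab : a ≤ b) :
    (1 + T 1 : LaurentPolynomial (ZMod 2)) ∣ T a + T b := by
  obtain ⟨m, rfl⟩ := Int.le.dest hab
  have h : (T a + T (a + m) : LaurentPolynomial (ZMod 2)) = T a * (1 + T m) := by
    rw [T_add]; ring
  rw [h]
  exact (one_add_T_one_dvd_one_add_T m).mul_left _

lemma one_add_T_one_dvd_one_add_T_of_nonneg {b : ℤ} (hb : 0 ≤ b) :
    (1 + T 1 : LaurentPolynomial (ZMod 2)) ∣ 1 + T b := by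
  simpa using one_add_T_one_dvd_T_add_T hb

/-- A common divisor of the first row divides every `2×2` minor. -/
lemma dvd_det_submatrix_of_dvd_first_row {R ι : Type*} [CommRing R] {r : R}
    {A : Matrix (Fin 2) ι R} (h : ∀ j, r ∣ A 0 j) (c₁ c₂ : ι) :
    r ∣ (A.submatrix id ![c₁, c₂]).det := by
  rw [Matrix.det_fin_two]
  exact dvd_sub ((h c₁).mul_right _) ((h c₂).mul_right _)

/-- For `n = 6k + 5`, the ideal of `(ℤ/2ℤ)[t,t⁻¹]` generated by the `2×2` minors of
the `2×2n` twisted Alexander matrix `A = (B₁ B₂ ⋯ Bₙ)` of Suzuki's theta-`n` curve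
equals the principal ideal `(1 + t)`. -/
theorem twisted_alexander_ideal_6k5 (k n : ℕ) (hn : n = 6 * k + 5)
    (B : ℕ → Matrix (Fin 2) (Fin 2) (LaurentPolynomial (ZMod 2)))
    (A : Matrix (Fin 2) (Fin (2 * n)) (LaurentPolynomial (ZMod 2)))
    (hB1 : B 1 = (T (-(6 * (k : ℤ) + 4)) : LaurentPolynomial (ZMod 2)) •
      !![T 1 + T (6 * (k : ℤ) + 4), 1 + T 1;
         1, T 1 + T (6 * (k : ℤ) + 4)])
    (hBtwo : ∀ j, 2 ≤ j → j ≤ 6 * k + 2 → j % 3 = 2 →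
      B j = (T ((j : ℤ) - 6 * k - 6) : LaurentPolynomial (ZMod 2)) •
        !![T 1 + T 2, 1 + T 1; 1 + T 2, T 1 + T 2])
    (hBzero : ∀ j, 3 ≤ j → j ≤ 6 * k → j % 3 = 0 →
      B j = (T ((j : ℤ) - 6 * k - 6) : LaurentPolynomial (ZMod 2)) •
        !![1 + T 1, 1 + T 2; T 1 + T 2, 1 + T 1])
    (hBone : ∀ j, 4 ≤ j → j ≤ 6 * k + 1 → j % 3 = 1 →
      B j = (T ((j : ℤ) - 6 * k - 6) : LaurentPolynomial (ZMod 2)) •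
        !![1 + T 2, T 1 + T 2; 1 + T 1, 1 + T 2])
    (hB3 : B (6 * k + 3) = (T (-3) : LaurentPolynomial (ZMod 2)) •
      !![1 + T 1, 1 + T 2; T 1 + T 2, 1 + T 1 + T 2])
    (hB4 : B (6 * k + 4) = (T (-(6 * (k : ℤ) + 5)) : LaurentPolynomial (ZMod 2)) •
      !![T (6 * (k : ℤ) + 3) + T (6 * (k : ℤ) + 4), 1 + T (6 * (k : ℤ) + 4);
         1 + T (6 * (k : ℤ) + 3), 1 + T (6 * (k : ℤ) + 3) + T (6 * (k : ℤ) + 4)])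
    (hB5 : B (6 * k + 5) = (T (-1) : LaurentPolynomial (ZMod 2)) •
      !![1 + T 1, 1 + T 2; T 2, 1 + T 1 + T 2])
    (hA : ∀ (i : Fin 2) (j : Fin (2 * n)),
      A i j = B (j.val / 2 + 1) i ⟨j.val % 2, Nat.mod_lt _ (by norm_num)⟩) :
    Ideal.span {d : LaurentPolynomial (ZMod 2) | ∃ c₁ c₂ : Fin (2 * n), c₁ < c₂ ∧
        d = (A.submatrix id ![c₁, c₂]).det} =
      Ideal.span {1 + T 1} := by
  have hrow : ∀ j, 1 ≤ j → j ≤ 6 * k + 5 → ∀ c, 1 + T 1 ∣ B j 0 c := by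
    intro j h1 h2 c
    have hj : j = 1 ∨ j = 6 * k + 3 ∨ j = 6 * k + 4 ∨ j = 6 * k + 5 ∨
        (2 ≤ j ∧ j ≤ 6 * k + 2) := by omega
    rcases hj with rfl | rfl | rfl | rfl | ⟨hl, hu⟩
    · rw [hB1]
      fin_cases c
      · exact (one_add_T_one_dvd_T_add_T (by omega)).mul_left _
      · exact (one_add_T_one_dvd_one_add_T_of_nonneg (by omega)).mul_left _
    · rw [hB3]
      fin_cases c <;>
        exact (one_add_T_one_dvd_one_add_T_of_nonneg (by omega)).mul_left _
    · rw [hB4]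
      fin_cases c
      · exact (one_add_T_one_dvd_T_add_T (by omega)).mul_left _
      · exact (one_add_T_one_dvd_one_add_T_of_nonneg (by omega)).mul_left _
    · rw [hB5]
      fin_cases c <;>
        exact (one_add_T_one_dvd_one_add_T_of_nonneg (by omega)).mul_left _
    · have hmod : j % 3 = 0 ∨ j % 3 = 1 ∨ j % 3 = 2 := by omega
      rcases hmod with h | h | h
      · rw [hBzero j (by omega) (by omega) h]
        fin_cases c <;>
          exact (one_add_T_one_dvd_one_add_T_of_nonneg (by omega)).mul_left _
      · rw [hBone j (by omega) (by omega) h]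
        fin_cases c
        · exact (one_add_T_one_dvd_one_add_T_of_nonneg (by omega)).mul_left _
        · exact (one_add_T_one_dvd_T_add_T (by omega)).mul_left _
      · rw [hBtwo j hl hu h]
        fin_cases c
        · exact (one_add_T_one_dvd_T_add_T (by omega)).mul_left _
        · exact (one_add_T_one_dvd_one_add_T_of_nonneg (by omega)).mul_left _
  apply le_antisymm
  · rw [Ideal.span_le]
    rintro _ ⟨c₁, c₂, -, rfl⟩
    refine Ideal.mem_span_singleton.2 (dvd_det_submatrix_of_dvd_first_row (fun j => ?_) c₁ c₂)
    rw [hA]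
    exact hrow _ (by omega) (by omega) _
  · rw [Ideal.span_singleton_le_iff_mem]
    -- The first columns of the blocks `6k + 3` and `6k + 5` have minor `t⁻³ (1 + t)`.
    let c₁ : Fin (2 * n) := ⟨2 * (6 * k + 2), by omega⟩
    let c₂ : Fin (2 * n) := ⟨2 * (6 * k + 4), by omega⟩
    have hc₁ : ∀ i, A i c₁ = B (6 * k + 3) i 0 := by
      intro i
      rw [hA]
      congr 1
      · simp only [c₁]; omega
      · ext; simp [c₁]
    have hc₂ : ∀ i, A i c₂ = B (6 * k + 5) i 0 := by
      intro i
      rw [hA]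
      congr 1
      · simp only [c₂]; omega
      · ext; simp [c₂]
    have hdet : (1 + T 1 : LaurentPolynomial (ZMod 2)) =
        T 3 * (A.submatrix id ![c₁, c₂]).det := by
      have e : (A.submatrix id ![c₁, c₂]).det = A 0 c₁ * A 1 c₂ - A 0 c₂ * A 1 c₁ := by
        rw [Matrix.det_fin_two]; rfl
      have h3 : (T 3 * T (-3) : LaurentPolynomial (ZMod 2)) = 1 := by
        rw [← T_add]; exact T_zero
      have h1 : (T (-1) * T 1 : LaurentPolynomial (ZMod 2)) = 1 := by
        rw [← T_add]; exact T_zero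
      rw [e, hc₁, hc₁, hc₂, hc₂, hB3, hB5]
      simp only [Matrix.smul_apply, Matrix.of_apply, Matrix.cons_val', Matrix.cons_val_zero,
        Matrix.cons_val_one, Matrix.cons_val_fin_one, smul_eq_mul]
      linear_combination (1 + T 1) * (T (-1) * T 1) * h3 + (1 + T 1) * h1 +
        (1 + T 1) * two_eq_zero_laurent
    rw [hdet]
    exact Ideal.mul_mem_left _ _ (Ideal.subset_span ⟨c₁, c₂, by simp [c₁, c₂], rfl⟩)
end
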